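/- The map f sending p = (p₁,p₂,p₃), with pᵢ > 0 and strict triangle inequalities p₁ < p₂+p₃, p₂ < p₁+p₃, p₃ < p₁+p₂, to the symmetric unit-diagonal matrix with a₁₂ = (p₃²-p₁²-p₂²)/(2p₁p₂), a₁₃ = (p₂²-p₁²-p₃²)/(2p₁p₃), a₂₃ = (p₁²-p₂²-p₃²)/(2p₂p₃), satisfies: if f(p) = f(p') then p and p' are parallel (i.e., p' = c·p for some c > 0). -/

import Mathlib

noncomputable def fMat (p : Fin 3 → ℝ) : Matrix (Fin 3) (Fin 3) ℝ :=
  !![1, ((p 2) ^ 2 - (p 0) ^ 2 - (p 1) ^ 2) / (2 * p 0 * p 1),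
      ((p 1) ^ 2 - (p 0) ^ 2 - (p 2) ^ 2) / (2 * p 0 * p 2);
    ((p 2) ^ 2 - (p 0) ^ 2 - (p 1) ^ 2) / (2 * p 0 * p 1), 1,
      ((p 0) ^ 2 - (p 1) ^ 2 - (p 2) ^ 2) / (2 * p 1 * p 2);
    ((p 1) ^ 2 - (p 0) ^ 2 - (p 2) ^ 2) / (2 * p 0 * p 2),
      ((p 0) ^ 2 - (p 1) ^ 2 - (p 2) ^ 2) / (2 * p 1 * p 2), 1]

theorem fMat_mulVec_self (p : Fin 3 → ℝ) (hp : ∀ i, 0 < p i) :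
    (fMat p).mulVec p = 0 := by
  have h0 := (hp 0).ne'
  have h1 := (hp 1).ne'
  have h2 := (hp 2).ne'
  funext i
  fin_cases i <;> simp [fMat, Matrix.mulVec, dotProduct, Fin.sum_univ_three] <;>
    field_simp <;> ring

theorem fMat_apply_zero_one_sq_lt_one (p : Fin 3 → ℝ) (hp : ∀ i, 0 < p i)
    (ht : p 0 < p 1 + p 2 ∧ p 1 < p 0 + p 2 ∧ p 2 < p 0 + p 1) :
    fMat p 0 1 ^ 2 < 1 := by
  obtain ⟨h0, h1, h2⟩ := ht
  have hp0 := hp 0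
  have hp1 := hp 1
  have hp2 := hp 2
  have hpos : 0 < 2 * p 0 * p 1 := by positivity
  rw [sq_lt_one_iff_abs_lt_one, abs_lt]
  simp only [fMat, Matrix.of_apply, Matrix.cons_val]
  rw [lt_div_iff₀ hpos, div_lt_one hpos]
  constructor
  · nlinarith [mul_pos (sub_pos.2 h0) (sub_pos.2 h1)]
  · nlinarith

theorem stmt_13 (p p' : Fin 3 → ℝ)
    (hp : ∀ i, 0 < p i) (hp' : ∀ i, 0 < p' i)
    (ht : p 0 < p 1 + p 2 ∧ p 1 < p 0 + p 2 ∧ p 2 < p 0 + p 1)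
    (ht' : p' 0 < p' 1 + p' 2 ∧ p' 1 < p' 0 + p' 2 ∧ p' 2 < p' 0 + p' 1)
    (hf : fMat p = fMat p') :
    ∃ c : ℝ, 0 < c ∧ p' = c • p := by
  have ha := fMat_apply_zero_one_sq_lt_one p hp ht
  have hk := fMat_mulVec_self p hp
  have hk' := fMat_mulVec_self p' hp'
  rw [← hf] at hk'
  have hs : fMat p 1 0 = fMat p 0 1 := rfl
  have hd0 : fMat p 0 0 = 1 := rfl
  have hd1 : fMat p 1 1 = 1 := rfl
  have e0 := congrFun hk 0
  have e1 := congrFun hk 1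
  have e0' := congrFun hk' 0
  have e1' := congrFun hk' 1
  simp only [Matrix.mulVec, dotProduct, Fin.sum_univ_three, Pi.zero_apply, hs, hd0, hd1]
    at e0 e1 e0' e1'
  generalize fMat p 0 1 = a at *
  generalize fMat p 0 2 = b at *
  generalize fMat p 1 2 = c at *
  have hne : 1 - a ^ 2 ≠ 0 := by linarith
  have h0 : p' 0 * p 2 = p' 2 * p 0 := by
    apply mul_left_cancel₀ hne
    linear_combination p 2 * (e0' - a * e1') - p' 2 * (e0 - a * e1)
  have h1 : p' 1 * p 2 = p' 2 * p 1 := by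
    apply mul_left_cancel₀ hne
    linear_combination p 2 * (e1' - a * e0') - p' 2 * (e1 - a * e0)
  have hp2 := (hp 2).ne'
  refine ⟨p' 2 / p 2, div_pos (hp' 2) (hp 2), ?_⟩
  funext i
  fin_cases i <;> simp <;> field_simp <;> assumption
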